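/- With T_a the metaplectic Demazure–Lusztig operator (Chinta–Gunnells version) as above, for any λ in the coweight lattice with ⟨λ, a⟩ > 0, T_a maps e^λ to the Laurent polynomial Σ_{k>0, k n(a^∨) ≤ ⟨λ,a⟩} (1−v)·e^{λ − k n(a^∨)a^∨} + v·g_{Q(a^∨)+B(λ,a^∨)}·e^{w_aλ − a^∨}; in particular T_a(e^λ) lies in ℂ_v[Λ^∨] (no denominators). -/

import Mathlib

/-- Telescoping of the geometric sum with ratio `e^{-β}`. -/
theorem one_sub_mul_sum_Icc_exp {F : Type*} [Field F] {Λ : Type*} [AddCommGroup Λ]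
    (e : Λ → F) (he : ∀ μ ν : Λ, e (μ + ν) = e μ * e ν) (β lam : Λ) (q : ℕ) :
    (1 - e β) * ∑ k ∈ Finset.Icc (1 : ℤ) q, e (lam - k • β) =
      e (lam - (q : ℤ) • β) - e lam := by
  induction q with
  | zero => simp
  | succ q ih =>
    have hset : Finset.Icc (1 : ℤ) ((q + 1 : ℕ) : ℤ) =
        insert ((q + 1 : ℕ) : ℤ) (Finset.Icc (1 : ℤ) q) := by
      ext k
      simp only [Finset.mem_Icc, Finset.mem_insert]
      omega
    have hstep : e (lam - (q : ℤ) • β) = e β * e (lam - ((q + 1 : ℕ) : ℤ) • β) := by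
      rw [← he]
      congr 1
      push_cast
      module
    rw [hset, Finset.sum_insert (by simp), mul_add, ih, hstep]
    ring

/-- Metaplectic Demazure–Lusztig operator on a monomial `e^λ`
with `⟨λ,a⟩ > 0` (rank one; notation as in the Chinta–Gunnells construction:
`n(a∨) = na`, `Q(a∨) = Qa`, `B(λ,a∨) = ⟨λ,a⟩·Qa`, `w_aλ = λ − ⟨λ,a⟩a∨`,
`w_a ⋆ e^λ = (e^{w_aλ}/(1 − v e^{−na·a∨}))·[(1−v)e^{res_{na}(⟨λ,a⟩)a∨}
  − v·g_{Qa+B(λ,a∨)}·e^{(na−1)a∨}(1 − e^{−na·a∨})]`, and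
`T_a(e^λ) = c(a∨)·(w_a ⋆ e^λ) + b(a∨)·e^λ` with
`c(a∨) = (1 − v e^{−na·a∨})/(1 − e^{na·a∨})`,
`b(a∨) = (v−1)/(1 − e^{na·a∨})`).  Then
`T_a(e^λ) = Σ_{k>0, k·na ≤ ⟨λ,a⟩} (1−v)·e^{λ−k·na·a∨}
  + v·g_{Qa+B(λ,a∨)}·e^{w_aλ−a∨}`,
a Laurent polynomial (no denominators). -/
theorem metaplectic_T_polynomial
    {F : Type*} [Field F] {Λ : Type*} [AddCommGroup Λ]
    (e : Λ → F) (he : ∀ μ ν : Λ, e (μ + ν) = e μ * e ν) (he0 : e 0 = 1)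
    (v : F) (av : Λ) (na n : ℕ) (hna : 0 < na) (hn : 0 < n)
    (Qa : ℤ) (g : ℤ → F)
    (hg0 : g 0 = -1)
    (hgmod : ∀ j : ℤ, g (j + n) = g j)
    (hgpair : ∀ j : ℤ, ¬ (n : ℤ) ∣ j → g j * g ((n : ℤ) - j) = v⁻¹)
    (pair : Λ → ℤ) (lam : Λ) (hlam : 0 < pair lam)
    (hX : e ((na : ℤ) • av) ≠ 1)
    (hvX : v * e (-((na : ℤ) • av)) ≠ 1) :
    ((1 - v * e (-((na : ℤ) • av))) / (1 - e ((na : ℤ) • av))) *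
        ((e (lam - pair lam • av) / (1 - v * e (-((na : ℤ) • av)))) *
          ((1 - v) * e ((pair lam % (na : ℤ)) • av) -
            v * g (Qa + pair lam * Qa) *
              (e (((na : ℤ) - 1) • av) * (1 - e (-((na : ℤ) • av)))))) +
      ((v - 1) / (1 - e ((na : ℤ) • av))) * e lam =
    (∑ k ∈ Finset.Icc (1 : ℤ) (pair lam / (na : ℤ)),
        (1 - v) * e (lam - (k * (na : ℤ)) • av)) +
      v * g (Qa + pair lam * Qa) * e ((lam - pair lam • av) - av) := by
  have hX' : 1 - e ((na : ℤ) • av) ≠ 0 := sub_ne_zero.mpr hX.symm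
  have hvX' : 1 - v * e (-((na : ℤ) • av)) ≠ 0 := sub_ne_zero.mpr hvX.symm
  obtain ⟨q, hq⟩ := Int.eq_ofNat_of_zero_le
    (Int.ediv_nonneg hlam.le (Int.natCast_nonneg na))
  have hdiv : pair lam = q * na + pair lam % na := by
    rw [← hq]
    exact (Int.ediv_mul_add_emod _ _).symm
  have hsum := one_sub_mul_sum_Icc_exp e he ((na : ℤ) • av) lam q
  have hres : e (lam - pair lam • av) * e ((pair lam % (na : ℤ)) • av) =
      e (lam - (q : ℤ) • (na : ℤ) • av) := by
    rw [← he]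
    congr 1
    nth_rewrite 1 [hdiv]
    module
  have hshift : e (lam - pair lam • av) * e (((na : ℤ) - 1) • av) =
      e ((na : ℤ) • av) * e ((lam - pair lam • av) - av) := by
    rw [← he, ← he]
    congr 1
    module
  have hinv : e ((na : ℤ) • av) * e (-((na : ℤ) • av)) = 1 := by
    rw [← he, add_neg_cancel, he0]
  rw [hq, ← Finset.mul_sum]
  simp only [mul_smul]
  rw [← mul_assoc, div_mul_div_cancel₀' hvX', div_mul_eq_mul_div, div_mul_eq_mul_div,
    ← add_div, div_eq_iff hX']
  linear_combination (1 - v) * hres -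
    v * g (Qa + pair lam * Qa) * (1 - e (-((na : ℤ) • av))) * hshift +
    v * g (Qa + pair lam * Qa) * e ((lam - pair lam • av) - av) * hinv - (1 - v) * hsum
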